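/- arXiv:1608.06875 — 2 statements merged into one kernel-verified Lean document; each statement's English description precedes it below -/
import Mathlib

section
/- Let n ≥ 2 and let D be a torsion-free affine connection on ℝⁿ with smooth Christoffel symbols Γ^C_{AB} and Ricci curvature Ric_{AB}. Let g be the Patterson–Walker metric of D on ℝ^{2n}. Then the Ricci curvature of g (computed in coordinates from its Levi-Civita Christoffel symbols) is the pullback of the symmetrized Ricci curvature of D: at every point (x,p), Ric(g)_{x^A x^B} = Ric_{AB}(x) + Ric_{BA}(x), and all components of Ric(g) having at least one p-index vanish, i.e. Ric(g)_{x^A p_B} = Ric(g)_{p_B x^A} = Ric(g)_{p_A p_B} = 0. -/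
open scoped BigOperators

/-- Partial derivative of a function on `ι → ℝ` in coordinate direction `i`. -/
noncomputable def pd {ι : Type} [Fintype ι] [DecidableEq ι] (i : ι)
    (f : (ι → ℝ) → ℝ) (x : ι → ℝ) : ℝ :=
  fderiv ℝ f x (Pi.single i 1)

/-- Ricci curvature of an affine connection given by coefficients `Γ k i j`. -/
noncomputable def ricConn {ι : Type} [Fintype ι] [DecidableEq ι]
    (Γ : ι → ι → ι → (ι → ℝ) → ℝ) (i j : ι) (x : ι → ℝ) : ℝ :=
  (∑ k, pd k (fun y => Γ k i j y) x) - (∑ k, pd i (fun y => Γ k k j y) x)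
    + ∑ k, ∑ l, (Γ k k l x * Γ l i j x - Γ k i l x * Γ l k j x)

/-- Levi-Civita Christoffel symbols of a metric in coordinates. -/
noncomputable def christoffel {ι : Type} [Fintype ι] [DecidableEq ι]
    (G : (ι → ℝ) → Matrix ι ι ℝ) (k i j : ι) (x : ι → ℝ) : ℝ :=
  (1/2) * ∑ l, (G x)⁻¹ k l *
    (pd i (fun y => G y j l) x + pd j (fun y => G y i l) x - pd l (fun y => G y i j) x)

/-- Laplacian of a metric in coordinates, applied to a function. -/
noncomputable def laplacian {ι : Type} [Fintype ι] [DecidableEq ι]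
    (G : (ι → ℝ) → Matrix ι ι ℝ) (F : (ι → ℝ) → ℝ) (x : ι → ℝ) : ℝ :=
  ∑ i, ∑ j, (G x)⁻¹ i j *
    (pd i (fun y => pd j F y) x - ∑ k, christoffel G k i j x * pd k F x)

/-- Lie derivative of a metric along a vector field, in coordinates. -/
noncomputable def lieDeriv {ι : Type} [Fintype ι] [DecidableEq ι]
    (X : ι → (ι → ℝ) → ℝ) (G : (ι → ℝ) → Matrix ι ι ℝ) (i j : ι) (x : ι → ℝ) : ℝ :=
  (∑ k, X k x * pd k (fun y => G y i j) x)
  + (∑ k, pd i (X k) x * G x k j) + ∑ k, pd j (X k) x * G x i k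

/-- Index type for the ambient space: `t`, `x^A`, `p_A`, `ρ`. -/
abbrev AmbIdx (n : ℕ) : Type := Unit ⊕ (Fin n ⊕ (Fin n ⊕ Unit))

def it (n : ℕ) : AmbIdx n := Sum.inl ()
def ix {n : ℕ} (A : Fin n) : AmbIdx n := Sum.inr (Sum.inl A)
def ip {n : ℕ} (A : Fin n) : AmbIdx n := Sum.inr (Sum.inr (Sum.inl A))
def irho (n : ℕ) : AmbIdx n := Sum.inr (Sum.inr (Sum.inr ()))

/-- The `x`-coordinates of an ambient point. -/
def xc {n : ℕ} (u : AmbIdx n → ℝ) : Fin n → ℝ := fun A => u (ix A)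

/-- The ambient metric of the affine connection `Γ`. -/
noncomputable def ambientMetric (n : ℕ) (Γ : Fin n → Fin n → Fin n → (Fin n → ℝ) → ℝ)
    (u : AmbIdx n → ℝ) : Matrix (AmbIdx n) (AmbIdx n) ℝ :=
  Matrix.of fun a b =>
    match a, b with
    | Sum.inl _, Sum.inl _ => 2 * u (irho n)
    | Sum.inl _, Sum.inr (Sum.inr (Sum.inr _)) => u (it n)
    | Sum.inr (Sum.inr (Sum.inr _)), Sum.inl _ => u (it n)
    | Sum.inr (Sum.inl A), Sum.inr (Sum.inr (Sum.inl B)) =>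
        (u (it n))^2 * (if A = B then (1:ℝ) else 0)
    | Sum.inr (Sum.inr (Sum.inl A)), Sum.inr (Sum.inl B) =>
        (u (it n))^2 * (if A = B then (1:ℝ) else 0)
    | Sum.inr (Sum.inl A), Sum.inr (Sum.inl B) =>
        (u (it n))^2 * (-2 * ∑ C, u (ip C) * Γ C A B (xc u)
          + (2 * u (irho n) / ((n:ℝ) - 1)) * ricConn Γ A B (xc u))
    | _, _ => 0

/-- The Patterson–Walker metric of a torsion-free affine connection with
coefficients `Γ`, on the doubled space with coordinates `(x, y)`. -/
noncomputable def pwGen {ι : Type} [Fintype ι] [DecidableEq ι]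
    (Γ : ι → ι → ι → (ι → ℝ) → ℝ) (u : (ι ⊕ ι) → ℝ) : Matrix (ι ⊕ ι) (ι ⊕ ι) ℝ :=
  Matrix.of fun a b =>
    match a, b with
    | Sum.inl i, Sum.inl j => -2 * ∑ k, u (Sum.inr k) * Γ k i j (fun l => u (Sum.inl l))
    | Sum.inl i, Sum.inr j => if i = j then (1:ℝ) else 0
    | Sum.inr i, Sum.inl j => if i = j then (1:ℝ) else 0
    | Sum.inr _, Sum.inr _ => 0

/-- `D` preserves a volume form: there is a smooth positive `v` with
`∑_C Γ^C_{AC} = ∂_A (log v)`. -/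
def PreservesVolume (n : ℕ) (Γ : Fin n → Fin n → Fin n → (Fin n → ℝ) → ℝ) : Prop :=
  ∃ v : (Fin n → ℝ) → ℝ, ContDiff ℝ (⊤ : ℕ∞) v ∧ (∀ x, 0 < v x) ∧
    ∀ (A : Fin n) (x : Fin n → ℝ), (∑ C, Γ C A C x) = pd A (fun y => Real.log (v y)) x

/-- Index type for the Thomas cone: `x^0` and `x^A`. -/
abbrev ThIdx (n : ℕ) : Type := Unit ⊕ Fin n

/-- The Thomas cone connection of the affine connection `Γ`. -/
noncomputable def thomasConn (n : ℕ) (Γ : Fin n → Fin n → Fin n → (Fin n → ℝ) → ℝ) :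
    ThIdx n → ThIdx n → ThIdx n → ((ThIdx n) → ℝ) → ℝ := fun c a b u =>
  match c, a, b with
  | Sum.inr C, Sum.inr A, Sum.inr B => Γ C A B (fun E => u (Sum.inr E))
  | Sum.inl _, Sum.inr A, Sum.inr B =>
      -(u (Sum.inl ()) / ((n:ℝ) - 1)) * ricConn Γ A B (fun E => u (Sum.inr E))
  | Sum.inr B, Sum.inr A, Sum.inl _ => if A = B then 1 / u (Sum.inl ()) else 0
  | Sum.inr B, Sum.inl _, Sum.inr A => if A = B then 1 / u (Sum.inl ()) else 0
  | _, _, _ => 0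

section PattersonWalker

variable {ι : Type} [Fintype ι]

lemma hasFDerivAt_comp_inl (u : ι ⊕ ι → ℝ) {f : (ι → ℝ) → ℝ}
    (hf : DifferentiableAt ℝ f (fun l => u (Sum.inl l))) :
    HasFDerivAt (fun y : ι ⊕ ι → ℝ => f (fun l => y (Sum.inl l)))
      ((fderiv ℝ f (fun l => u (Sum.inl l))).comp
        (ContinuousLinearMap.pi fun l => ContinuousLinearMap.proj (Sum.inl l))) u :=
  hf.hasFDerivAt.comp u
    (ContinuousLinearMap.pi fun l : ι =>
      (ContinuousLinearMap.proj (Sum.inl l) : (ι ⊕ ι → ℝ) →L[ℝ] ℝ)).hasFDerivAt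

variable [DecidableEq ι]

lemma pd_const (i : ι) (c : ℝ) (x : ι → ℝ) : pd i (fun _ => c) x = 0 := by
  simp [pd]

lemma pd_const_mul (i : ι) (c : ℝ) (f : (ι → ℝ) → ℝ) (x : ι → ℝ) :
    pd i (fun y => c * f y) x = c * pd i f x := by
  change fderiv ℝ (c • f) x (Pi.single i 1) = c * fderiv ℝ f x (Pi.single i 1)
  simp [fderiv_const_smul_field]

lemma pd_neg (i : ι) (f : (ι → ℝ) → ℝ) (x : ι → ℝ) :
    pd i (fun y => -f y) x = -pd i f x := by
  simp [pd, fderiv_fun_neg]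

section PartialDerivatives

variable (u : ι ⊕ ι → ℝ)

lemma pd_inl_comp_inl {f : (ι → ℝ) → ℝ}
    (hf : DifferentiableAt ℝ f (fun l => u (Sum.inl l))) (i : ι) :
    pd (Sum.inl i) (fun y : ι ⊕ ι → ℝ => f (fun l => y (Sum.inl l))) u
      = pd i f (fun l => u (Sum.inl l)) := by
  rw [pd, (hasFDerivAt_comp_inl u hf).fderiv, pd]
  simp only [ContinuousLinearMap.comp_apply]
  congr 1
  ext l
  simp [Pi.single_apply]

lemma pd_inr_comp_inl {f : (ι → ℝ) → ℝ}
    (hf : DifferentiableAt ℝ f (fun l => u (Sum.inl l))) (i : ι) :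
    pd (Sum.inr i) (fun y : ι ⊕ ι → ℝ => f (fun l => y (Sum.inl l))) u = 0 := by
  rw [pd, (hasFDerivAt_comp_inl u hf).fderiv]
  simp only [ContinuousLinearMap.comp_apply]
  convert map_zero (fderiv ℝ f (fun l => u (Sum.inl l)))
  ext l
  simp

lemma pd_sum_fiber_mul {f : ι → (ι → ℝ) → ℝ}
    (hf : ∀ k, DifferentiableAt ℝ (f k) (fun l => u (Sum.inl l))) (a : ι ⊕ ι) :
    pd a (fun y : ι ⊕ ι → ℝ => ∑ k, y (Sum.inr k) * f k (fun l => y (Sum.inl l))) u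
      = ∑ k, (u (Sum.inr k) * pd a (fun y : ι ⊕ ι → ℝ => f k (fun l => y (Sum.inl l))) u
          + f k (fun l => u (Sum.inl l)) * (Pi.single a 1 : ι ⊕ ι → ℝ) (Sum.inr k)) := by
  have h : HasFDerivAt
      (fun y : ι ⊕ ι → ℝ => ∑ k, y (Sum.inr k) * f k (fun l => y (Sum.inl l))) _ u :=
    HasFDerivAt.fun_sum fun k _ => ((ContinuousLinearMap.proj (Sum.inr k) :
      (ι ⊕ ι → ℝ) →L[ℝ] ℝ).hasFDerivAt).mul (hasFDerivAt_comp_inl u (hf k))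
  simp only [pd]
  rw [h.fderiv]
  simp [fun k => (hasFDerivAt_comp_inl u (hf k)).fderiv]

lemma pd_inl_sum_fiber_mul {f : ι → (ι → ℝ) → ℝ}
    (hf : ∀ k, DifferentiableAt ℝ (f k) (fun l => u (Sum.inl l))) (i : ι) :
    pd (Sum.inl i) (fun y : ι ⊕ ι → ℝ => ∑ k, y (Sum.inr k) * f k (fun l => y (Sum.inl l))) u
      = ∑ k, u (Sum.inr k) * pd i (f k) (fun l => u (Sum.inl l)) := by
  simp [pd_sum_fiber_mul u hf, pd_inl_comp_inl u (hf _)]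

lemma pd_inr_sum_fiber_mul {f : ι → (ι → ℝ) → ℝ}
    (hf : ∀ k, DifferentiableAt ℝ (f k) (fun l => u (Sum.inl l))) (i : ι) :
    pd (Sum.inr i) (fun y : ι ⊕ ι → ℝ => ∑ k, y (Sum.inr k) * f k (fun l => y (Sum.inl l))) u
      = f i (fun l => u (Sum.inl l)) := by
  simp [pd_sum_fiber_mul u hf, pd_inr_comp_inl u (hf _), Pi.single_apply]

end PartialDerivatives

variable (Γ : ι → ι → ι → (ι → ℝ) → ℝ)

lemma pwGen_inv (u : ι ⊕ ι → ℝ) :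
    (pwGen Γ u)⁻¹ = Matrix.fromBlocks 0 1 1
      (-Matrix.of fun i j => -2 * ∑ k, u (Sum.inr k) * Γ k i j (fun l => u (Sum.inl l))) := by
  have h : pwGen Γ u = Matrix.fromBlocks
      (Matrix.of fun i j => -2 * ∑ k, u (Sum.inr k) * Γ k i j (fun l => u (Sum.inl l)))
      1 1 0 := by
    ext (i | i) (j | j) <;> simp [pwGen, Matrix.one_apply]
  rw [h]
  apply Matrix.inv_eq_right_inv
  simp [Matrix.fromBlocks_multiply]

/-- The coefficient of `p_D` in the Christoffel symbol with upper index `p_C` and lower indices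
`x^A`, `x^B` of the Patterson–Walker metric. -/
noncomputable def pwFiberCoeff (D C A B : ι) (x : ι → ℝ) : ℝ :=
  pd C (Γ D A B) x - pd A (Γ D B C) x - pd B (Γ D A C) x + 2 * ∑ l, Γ D C l x * Γ l A B x

/-- The Christoffel symbols of the Patterson–Walker metric. -/
noncomputable def pwChristoffel : ι ⊕ ι → ι ⊕ ι → ι ⊕ ι → (ι ⊕ ι → ℝ) → ℝ
  | Sum.inl C, Sum.inl A, Sum.inl B, u => Γ C A B (fun l => u (Sum.inl l))
  | Sum.inr C, Sum.inl A, Sum.inl B, u =>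
      ∑ D, u (Sum.inr D) * pwFiberCoeff Γ D C A B (fun l => u (Sum.inl l))
  | Sum.inr C, Sum.inl A, Sum.inr B, u => -Γ B A C (fun l => u (Sum.inl l))
  | Sum.inr C, Sum.inr A, Sum.inl B, u => -Γ A B C (fun l => u (Sum.inl l))
  | _, _, _, _ => 0

variable {Γ}

lemma christoffel_pwGen (hΓ : ∀ C A B, Differentiable ℝ (Γ C A B)) :
    christoffel (pwGen Γ) = pwChristoffel Γ := by
  have hl (u : ι ⊕ ι → ℝ) (A B C : ι) := pd_inl_sum_fiber_mul u (f := fun k => Γ k A B)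
    (fun k => (hΓ k A B).differentiableAt) C
  have hr (u : ι ⊕ ι → ℝ) (A B C : ι) := pd_inr_sum_fiber_mul u (f := fun k => Γ k A B)
    (fun k => (hΓ k A B).differentiableAt) C
  ext (C | C) (A | A) (B | B) u <;>
    simp only [christoffel, pwGen_inv, Fintype.sum_sum_type] <;>
    simp [pwGen, pwChristoffel, pd_const_mul, pd_const, hl, hr, Matrix.one_apply, pd_neg]
  have hquad : ∑ l, (2 * ∑ D, u (Sum.inr D) * Γ D C l (fun m => u (Sum.inl m)))
        * (2 * Γ l A B (fun m => u (Sum.inl m)))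
      = 2 * ∑ D, u (Sum.inr D) * (2 * ∑ l, Γ D C l (fun m => u (Sum.inl m))
          * Γ l A B (fun m => u (Sum.inl m))) := by
    simp only [Finset.mul_sum, Finset.sum_mul]
    rw [Finset.sum_comm]
    exact Finset.sum_congr rfl fun D _ => Finset.sum_congr rfl fun l _ => by ring
  simp only [pwFiberCoeff, mul_add, mul_sub, Finset.sum_add_distrib, Finset.sum_sub_distrib]
  rw [hquad]
  ring

lemma pwChristoffel_inr_inr_self (hsym : ∀ C A B x, Γ C A B x = Γ C B A x) (C : ι) (j : ι ⊕ ι)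
    (u : ι ⊕ ι → ℝ) :
    pwChristoffel Γ (Sum.inr C) (Sum.inr C) j u
      = -pwChristoffel Γ (Sum.inl C) (Sum.inl C) j u := by
  cases j <;> simp [pwChristoffel, hsym C C]

lemma differentiable_pd {f : (ι → ℝ) → ℝ} (hf : ContDiff ℝ 2 f) (i : ι) :
    Differentiable ℝ (pd i f) :=
  ((hf.fderiv_right (m := 1) (by norm_num)).differentiable (by norm_num)).clm_apply
    (differentiable_const _)

lemma differentiable_pwFiberCoeff (hΓ : ∀ C A B, ContDiff ℝ 2 (Γ C A B)) (D C A B : ι) :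
    Differentiable ℝ (pwFiberCoeff Γ D C A B) := by
  have h₁ (C A B : ι) : Differentiable ℝ (Γ C A B) := (hΓ C A B).differentiable (by norm_num)
  have h₂ (C A B i : ι) := differentiable_pd (hΓ C A B) i
  unfold pwFiberCoeff
  fun_prop

/-- The connection of the Patterson–Walker metric preserves the coordinate volume form, so its
Ricci curvature loses all terms containing the trace of the Christoffel symbols. -/
lemma ricConn_pwChristoffel (hsym : ∀ C A B x, Γ C A B x = Γ C B A x) (i j : ι ⊕ ι)
    (u : ι ⊕ ι → ℝ) :
    ricConn (pwChristoffel Γ) i j u = ∑ k, pd k (fun y => pwChristoffel Γ k i j y) u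
      - ∑ k, ∑ l, pwChristoffel Γ k i l u * pwChristoffel Γ l k j u := by
  have hdiv : ∑ k, pd i (fun y => pwChristoffel Γ k k j y) u = 0 := by
    simp [Fintype.sum_sum_type, pwChristoffel_inr_inr_self hsym, pd_neg]
  have htr (l : ι ⊕ ι) : ∑ k, pwChristoffel Γ k k l u = 0 := by
    simp [Fintype.sum_sum_type, pwChristoffel_inr_inr_self hsym]
  have hquad : ∑ k, ∑ l, pwChristoffel Γ k k l u * pwChristoffel Γ l i j u = 0 := by
    rw [Finset.sum_comm]
    simp [← Finset.sum_mul, htr]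
  simp only [ricConn, hdiv, Finset.sum_sub_distrib, hquad]
  ring

lemma ricConn_pwChristoffel_inl_inl (hΓ : ∀ C A B, ContDiff ℝ 2 (Γ C A B))
    (hsym : ∀ C A B x, Γ C A B x = Γ C B A x) (A B : ι) (u : ι ⊕ ι → ℝ) :
    ricConn (pwChristoffel Γ) (Sum.inl A) (Sum.inl B) u
      = ricConn Γ A B (fun l => u (Sum.inl l)) + ricConn Γ B A (fun l => u (Sum.inl l)) := by
  have hx (C : ι) := pd_inl_comp_inl u
    ((hΓ C A B).differentiable (by norm_num)).differentiableAt C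
  have hp (C : ι) := pd_inr_sum_fiber_mul u (f := fun D => pwFiberCoeff Γ D C A B)
    (fun D => (differentiable_pwFiberCoeff hΓ D C A B).differentiableAt) C
  have hsymf (C A B : ι) : Γ C A B = Γ C B A := funext (hsym C A B)
  rw [ricConn_pwChristoffel hsym]
  simp only [Fintype.sum_sum_type]
  simp only [pwChristoffel, hx, hp, ricConn]
  simp only [pwFiberCoeff, Finset.sum_sub_distrib, Finset.sum_add_distrib, ← Finset.mul_sum,
    zero_mul, mul_zero, neg_mul_neg, Finset.sum_const_zero, add_zero, zero_add]
  simp only [hsymf, mul_comm]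
  ring

lemma ricConn_pwChristoffel_inl_inr (hΓ : ∀ C A B, Differentiable ℝ (Γ C A B))
    (hsym : ∀ C A B x, Γ C A B x = Γ C B A x) (A B : ι) (u : ι ⊕ ι → ℝ) :
    ricConn (pwChristoffel Γ) (Sum.inl A) (Sum.inr B) u = 0 := by
  have hp (C : ι) := pd_inr_comp_inl u (hΓ B A C).differentiableAt C
  rw [ricConn_pwChristoffel hsym]
  simp [Fintype.sum_sum_type, pwChristoffel, pd_const, pd_neg, hp]

lemma ricConn_pwChristoffel_inr_inl (hΓ : ∀ C A B, Differentiable ℝ (Γ C A B))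
    (hsym : ∀ C A B x, Γ C A B x = Γ C B A x) (A B : ι) (u : ι ⊕ ι → ℝ) :
    ricConn (pwChristoffel Γ) (Sum.inr B) (Sum.inl A) u = 0 := by
  have hp (C : ι) := pd_inr_comp_inl u (hΓ B A C).differentiableAt C
  rw [ricConn_pwChristoffel hsym]
  simp [Fintype.sum_sum_type, pwChristoffel, pd_const, pd_neg, hp]

lemma ricConn_pwChristoffel_inr_inr (hsym : ∀ C A B x, Γ C A B x = Γ C B A x) (A B : ι)
    (u : ι ⊕ ι → ℝ) :
    ricConn (pwChristoffel Γ) (Sum.inr A) (Sum.inr B) u = 0 := by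
  rw [ricConn_pwChristoffel hsym]
  simp [Fintype.sum_sum_type, pwChristoffel, pd_const]

end PattersonWalker

/-- The Ricci curvature of the Patterson–Walker metric is the
pullback of the symmetrized Ricci curvature of the affine connection. -/
theorem pw_metric_ricci_eq_symmetrized_pullback
    (n : ℕ) (hn : 2 ≤ n) (Γ : Fin n → Fin n → Fin n → (Fin n → ℝ) → ℝ)
    (hsmooth : ∀ C A B, ContDiff ℝ (⊤ : ℕ∞) (Γ C A B))
    (hsym : ∀ C A B x, Γ C A B x = Γ C B A x) :
    ∀ u : (Fin n ⊕ Fin n) → ℝ,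
      (∀ A B : Fin n,
        ricConn (christoffel (pwGen Γ)) (Sum.inl A) (Sum.inl B) u
          = ricConn Γ A B (fun E => u (Sum.inl E))
            + ricConn Γ B A (fun E => u (Sum.inl E))) ∧
      (∀ A B : Fin n, ricConn (christoffel (pwGen Γ)) (Sum.inl A) (Sum.inr B) u = 0) ∧
      (∀ A B : Fin n, ricConn (christoffel (pwGen Γ)) (Sum.inr B) (Sum.inl A) u = 0) ∧
      (∀ A B : Fin n, ricConn (christoffel (pwGen Γ)) (Sum.inr A) (Sum.inr B) u = 0) := by
  have h₂ (C A B : Fin n) : ContDiff ℝ 2 (Γ C A B) :=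
    (hsmooth C A B).of_le (WithTop.coe_le_coe.2 le_top)
  have h₁ (C A B : Fin n) : Differentiable ℝ (Γ C A B) := (h₂ C A B).differentiable (by norm_num)
  intro u
  rw [christoffel_pwGen h₁]
  exact ⟨fun A B => ricConn_pwChristoffel_inl_inl h₂ hsym A B u,
    fun A B => ricConn_pwChristoffel_inl_inr h₁ hsym A B u,
    fun A B => ricConn_pwChristoffel_inr_inl h₁ hsym A B u,
    fun A B => ricConn_pwChristoffel_inr_inr hsym A B u⟩
end

section
/- Let n ≥ 2 and let D be a torsion-free affine connection on ℝⁿ preserving a volume form, with ambient metric 𝐠 on Ω = ℝ_{>0} × ℝⁿ × ℝⁿ × ℝ. Then the (n+1)-dimensional distribution spanned by {∂_{p_A} (A ∈ Fin n), ∂_ρ} is totally isotropic and parallel for the Levi-Civita connection of 𝐠: (i) 𝐠_{ab} = 0 whenever both a and b are indices among the p_A and ρ coordinates, and (ii) the Levi-Civita Christoffel symbols Γ̃ of 𝐠 satisfy Γ̃^c_{ib} = 0 for every index i, every index b among the p_A and ρ coordinates, and every index c among the t and x^A coordinates. -/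
open scoped BigOperators

/-- An ambient index is *vertical* if it is one of the `p_A` or `ρ` directions. -/
def AmbVert {n : ℕ} (a : AmbIdx n) : Prop := (∃ A : Fin n, a = ip A) ∨ a = irho n

/-- An ambient index is *horizontal* if it is `t` or one of the `x^A` directions. -/
def AmbHor {n : ℕ} (a : AmbIdx n) : Prop := a = it n ∨ ∃ A : Fin n, a = ix A

/-- A function invariant under translation in direction `i` has vanishing `i`-th partial derivative. -/
theorem pd_eq_zero_of_translation_invariant {ι : Type} [Fintype ι] [DecidableEq ι] {i : ι}
    {f : (ι → ℝ) → ℝ} {x : ι → ℝ} (h : ∀ s : ℝ, f (x + s • Pi.single i 1) = f x) :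
    pd i f x = 0 := by
  by_cases hf : DifferentiableAt ℝ f x
  · rw [pd, ← hf.lineDeriv_eq_fderiv]
    simp [lineDeriv, h]
  · simp [pd, fderiv_zero_of_not_differentiableAt hf]

theorem ambientMetric_vert_vert {n : ℕ} (Γ : Fin n → Fin n → Fin n → (Fin n → ℝ) → ℝ)
    (u : AmbIdx n → ℝ) {a b : AmbIdx n} (ha : AmbVert a) (hb : AmbVert b) :
    ambientMetric n Γ u a b = 0 := by
  rcases ha with ⟨A, rfl⟩ | rfl <;> rcases hb with ⟨B, rfl⟩ | rfl <;> rfl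

/-- The components of the ambient metric with a vertical index depend only on `t`. -/
theorem ambientMetric_vert_congr {n : ℕ} (Γ : Fin n → Fin n → Fin n → (Fin n → ℝ) → ℝ)
    {u v : AmbIdx n → ℝ} (huv : u (it n) = v (it n)) (a : AmbIdx n) {b : AmbIdx n}
    (hb : AmbVert b) : ambientMetric n Γ u a b = ambientMetric n Γ v a b := by
  rcases hb with ⟨B, rfl⟩ | rfl <;> rcases a with _ | A | A | _ <;>
    simp [ambientMetric, ip, irho, huv]

theorem pd_vert_ambientMetric_vert {n : ℕ} (Γ : Fin n → Fin n → Fin n → (Fin n → ℝ) → ℝ)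
    (u : AmbIdx n → ℝ) (a : AmbIdx n) {b l : AmbIdx n} (hb : AmbVert b) (hl : AmbVert l) :
    pd b (fun y => ambientMetric n Γ y a l) u = 0 := by
  refine pd_eq_zero_of_translation_invariant fun s => ambientMetric_vert_congr Γ ?_ a hl
  rcases hb with ⟨B, rfl⟩ | rfl <;> simp [it, ip, irho]

/-- The inverse ambient metric vanishes on pairs of horizontal indices. -/
theorem ambientMetric_inv_hor_hor {n : ℕ} (Γ : Fin n → Fin n → Fin n → (Fin n → ℝ) → ℝ)
    {u : AmbIdx n → ℝ} (hu : u (it n) ≠ 0) {c l : AmbIdx n} (hc : AmbHor c) (hl : AmbHor l) :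
    (ambientMetric n Γ u)⁻¹ c l = 0 := by
  by_cases hdet : IsUnit (ambientMetric n Γ u).det
  · have key : ∀ v, AmbVert v →
        ∑ k, (ambientMetric n Γ u)⁻¹ c k * ambientMetric n Γ u k v = 0 := fun v hv => by
      rw [← Matrix.mul_apply, Matrix.nonsing_inv_mul _ hdet, Matrix.one_apply_ne]
      rcases hc with rfl | ⟨C, rfl⟩ <;> rcases hv with ⟨A, rfl⟩ | rfl <;>
        simp [it, ix, ip, irho]
    generalize (ambientMetric n Γ u)⁻¹ = K at key ⊢
    rcases hl with rfl | ⟨B, rfl⟩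
    · change K c (Sum.inl PUnit.unit) = 0
      simpa [ambientMetric, irho, hu] using key (irho n) (Or.inr rfl)
    · simpa [ambientMetric, ip, ix, hu] using key (ip B) (Or.inl ⟨B, rfl⟩)
  · simp [Matrix.nonsing_inv_apply_not_isUnit _ hdet]

theorem ambHor_or_ambVert {n : ℕ} (a : AmbIdx n) : AmbHor a ∨ AmbVert a := by
  rcases a with _ | A | A | _
  exacts [.inl (.inl rfl), .inl (.inr ⟨A, rfl⟩), .inr (.inl ⟨A, rfl⟩), .inr (.inr rfl)]

/-- The distribution spanned by `∂_{p_A}, ∂_ρ` is totally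
isotropic and parallel for the Levi-Civita connection of the ambient metric. -/
theorem ambient_parallel_isotropic_distribution
    (n : ℕ) (hn : 2 ≤ n) (Γ : Fin n → Fin n → Fin n → (Fin n → ℝ) → ℝ)
    (hsmooth : ∀ C A B, ContDiff ℝ (⊤ : ℕ∞) (Γ C A B))
    (hsym : ∀ C A B x, Γ C A B x = Γ C B A x)
    (hvol : PreservesVolume n Γ) :
    ∀ u : AmbIdx n → ℝ, 0 < u (it n) →
      (∀ a b : AmbIdx n, AmbVert a → AmbVert b → ambientMetric n Γ u a b = 0) ∧
      (∀ i b c : AmbIdx n, AmbVert b → AmbHor c →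
        christoffel (ambientMetric n Γ) c i b u = 0) := by
  refine fun u hu => ⟨fun a b => ambientMetric_vert_vert Γ u, fun i b c hb hc => ?_⟩
  rw [christoffel, Finset.sum_eq_zero, mul_zero]
  intro l _
  rcases ambHor_or_ambVert l with hl | hl
  · rw [ambientMetric_inv_hor_hor Γ hu.ne' hc hl, zero_mul]
  · have hbl : pd i (fun y => ambientMetric n Γ y b l) u = 0 :=
      pd_eq_zero_of_translation_invariant fun s => by
        rw [ambientMetric_vert_vert Γ _ hb hl, ambientMetric_vert_vert Γ _ hb hl]
    rw [hbl, pd_vert_ambientMetric_vert Γ u i hb hl, pd_vert_ambientMetric_vert Γ u i hl hb]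
    ring
end
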